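/- Conditional mean in the FDLM out-of-sample distribution: under the linear model ε = Φe + η with e ~ N(0, Σ), η ~ N(0, σ_η² I_M) independent, and scalar ε* = φ'e + η* with η* ~ N(0, σ_η²) independent of (e, η), the conditional distribution of ε* given ε is N(φ' Σ̃ Φ' ε, σ_η² + σ_η² φ' Σ̃ φ), where Σ̃ = diag(σ_j²/(σ_η² + σ_j²)) and Φ'Φ = I_J. -/

import Mathlib

open Matrix MeasureTheory ProbabilityTheory

lemma condDistrib_of_indep_residual {Ω E : Type*} [MeasurableSpace Ω] [MeasurableSpace E]
    (μ : Measure Ω) [IsProbabilityMeasure μ] (X : Ω → E) (R Y : Ω → ℝ)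
    (hX : Measurable X) (hR : Measurable R) (g : E → ℝ) (hg : Measurable g) (v : NNReal)
    (hind : IndepFun X R μ) (hlaw : μ.map R = gaussianReal 0 v)
    (hY : ∀ ω, Y ω = g (X ω) + R ω) :
    ∀ᵐ ω ∂μ, condDistrib Y X μ (X ω) = gaussianReal (g (X ω)) v := by
  have hYm : Measurable Y := by
    rw [show Y = fun ω => g (X ω) + R ω from funext hY]; fun_prop
  have hmeas : Measurable (fun x : E => gaussianReal (g x) v) :=
    measurable_gaussianReal.comp (hg.prodMk measurable_const)
  let κ : Kernel E ℝ := ⟨fun x => gaussianReal (g x) v, hmeas⟩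
  have hκ : ∀ x, κ x = gaussianReal (g x) v := fun x => rfl
  have : IsMarkovKernel κ := ⟨fun x => by rw [hκ]; infer_instance⟩
  have key : μ.map (fun ω => (X ω, Y ω)) = μ.map X ⊗ₘ κ := by
    have h1 : μ.map (fun ω => (X ω, Y ω))
        = ((μ.map X).prod (gaussianReal 0 v)).map (fun p : E × ℝ => (p.1, g p.1 + p.2)) := by
      rw [← hlaw, ← (indepFun_iff_map_prod_eq_prod_map_map hX.aemeasurable hR.aemeasurable).1 hind,
        Measure.map_map (by fun_prop) (by fun_prop)]
      congr 1
      funext ω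
      simp [hY]
    rw [h1]
    ext s hs
    have hT : Measurable (fun p : E × ℝ => (p.1, g p.1 + p.2)) := by fun_prop
    have : IsProbabilityMeasure (μ.map X) := Measure.isProbabilityMeasure_map hX.aemeasurable
    rw [Measure.map_apply hT hs, Measure.prod_apply (hT hs), Measure.compProd_apply hs]
    congr 1
    funext x
    rw [hκ, ← zero_add (g x), ← gaussianReal_map_const_add (g x), 
      Measure.map_apply (by fun_prop) (measurable_prodMk_left hs)]
    rfl
  exact ae_of_ae_map hX.aemeasurable (condDistrib_ae_eq_of_measure_eq_compProd X hYm.aemeasurable key)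

lemma indep_and_law_of_joint {Ω : Type*} [MeasurableSpace Ω] {M : ℕ}
    (μ : Measure Ω) [IsProbabilityMeasure μ] (X : Ω → Fin M → ℝ) (R : Ω → ℝ)
    (hX : Measurable X) (hR : Measurable R) (Q : (Fin M → ℝ) → ℝ) (hQ : ∀ a, 0 ≤ Q a)
    (hQ0 : Q 0 = 0) (v : ℝ) (hv : 0 ≤ v)
    (h : ∀ a t, μ.map (fun ω => a ⬝ᵥ X ω + t * R ω)
      = gaussianReal 0 (Q a + t ^ 2 * v).toNNReal) :
    IndepFun X R μ ∧ μ.map R = gaussianReal 0 v.toNNReal := by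
  refine ⟨?_, by simpa [hQ0] using h 0 1⟩
  rw [indepFun_iff_charFunDual_prod hX.aemeasurable hR.aemeasurable]
  intro L
  obtain ⟨a, ha⟩ : ∃ a : Fin M → ℝ, ∀ x, L (x, 0) = a ⬝ᵥ x := by
    refine ⟨fun i => L (Pi.single i 1, 0), fun x => ?_⟩
    have := (L.comp (.inl ℝ (Fin M → ℝ) ℝ)).toLinearMap.pi_apply_eq_sum_univ x
    simp only [ContinuousLinearMap.coe_coe, ContinuousLinearMap.comp_apply,
      ContinuousLinearMap.inl_apply] at this
    rw [this]
    simp only [dotProduct, smul_eq_mul]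
    refine Finset.sum_congr rfl fun i _ => ?_
    rw [mul_comm]
    congr 3
    ext j
    simp [Pi.single_apply, eq_comm]
  have ht : ∀ r : ℝ, L (0, r) = L (0, 1) * r := by
    intro r
    have : ((0, r) : (Fin M → ℝ) × ℝ) = r • (0, 1) := by simp
    rw [this, map_smul, smul_eq_mul, mul_comm]
  set t := L (0, 1)
  have hL : ∀ x r, L (x, r) = a ⬝ᵥ x + t * r := by
    intro x r
    rw [← ha, ← ht, ← map_add]; simp
  simp only [charFunDual_eq_charFun_map_one]
  rw [Measure.map_map (by fun_prop) (by fun_prop), Measure.map_map (by fun_prop) (by fun_prop),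
    Measure.map_map (by fun_prop) (by fun_prop)]
  have e1 : (L ∘ fun ω => (X ω, R ω)) = fun ω => a ⬝ᵥ X ω + t * R ω := by
    funext ω; simp [hL]
  have e2 : (L.comp (.inl ℝ (Fin M → ℝ) ℝ)) ∘ X = fun ω => a ⬝ᵥ X ω + 0 * R ω := by
    funext ω; simp [ha]
  have e3 : (L.comp (.inr ℝ (Fin M → ℝ) ℝ)) ∘ R = fun ω => (0 : Fin M → ℝ) ⬝ᵥ X ω + t * R ω := by
    funext ω; simp [ht]
  rw [e1, e2, e3, h, h, h, charFun_gaussianReal, charFun_gaussianReal, charFun_gaussianReal,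
    ← Complex.exp_add]
  congr 1
  have hq := hQ a
  have : 0 ≤ t ^ 2 * v := by positivity
  simp only [Real.coe_toNNReal', hQ0]
  rw [max_eq_left (by positivity), max_eq_left (by positivity), max_eq_left (by positivity)]
  push_cast
  ring

lemma fdlm_variance {M J : ℕ} (Φ : Matrix (Fin M) (Fin J) ℝ) (hΦ : Φᵀ * Φ = 1)
    (σ2 : Fin J → ℝ) (hσ2 : ∀ j, 0 < σ2 j) (s : ℝ) (hs : 0 < s)
    (φ : Fin J → ℝ) (d : Fin J → ℝ) (hd : ∀ j, d j = σ2 j / (s + σ2 j))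
    (b : Fin M → ℝ) (hb : b = Φ *ᵥ (diagonal d *ᵥ φ)) (a : Fin M → ℝ) (t : ℝ) :
    (Φᵀ *ᵥ (a - t • b) + t • φ) ⬝ᵥ (diagonal σ2 *ᵥ (Φᵀ *ᵥ (a - t • b) + t • φ))
      + (a - t • b) ⬝ᵥ ((s • (1 : Matrix (Fin M) (Fin M) ℝ)) *ᵥ (a - t • b)) + t ^ 2 * s
    = ((Φᵀ *ᵥ a) ⬝ᵥ (diagonal σ2 *ᵥ (Φᵀ *ᵥ a)) + s * (a ⬝ᵥ a))
      + t ^ 2 * (s + s * (φ ⬝ᵥ (diagonal d *ᵥ φ))) := by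
  have hΦb : Φᵀ *ᵥ b = diagonal d *ᵥ φ := by
    rw [hb, mulVec_mulVec, hΦ, one_mulVec]
  have hab : a ⬝ᵥ b = (Φᵀ *ᵥ a) ⬝ᵥ (diagonal d *ᵥ φ) := by
    rw [hb, dotProduct_mulVec, mulVec_transpose]
  have hbb : b ⬝ᵥ b = (diagonal d *ᵥ φ) ⬝ᵥ (diagonal d *ᵥ φ) := by
    conv_lhs => rw [hb, dotProduct_mulVec, ← mulVec_transpose, ← hb, hΦb]
  have h2 : (a - t • b) ⬝ᵥ ((s • (1 : Matrix (Fin M) (Fin M) ℝ)) *ᵥ (a - t • b))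
      = s * (a ⬝ᵥ a) - 2 * t * s * (a ⬝ᵥ b) + t ^ 2 * s * (b ⬝ᵥ b) := by
    rw [smul_mulVec, one_mulVec, dotProduct_smul]
    simp only [sub_dotProduct, dotProduct_sub, smul_dotProduct, dotProduct_smul, smul_eq_mul,
      dotProduct_comm b a]
    ring
  rw [h2, hab, hbb, mulVec_sub, mulVec_smul, hΦb]
  generalize Φᵀ *ᵥ a = c
  have h3 : (c - t • (diagonal d *ᵥ φ) + t • φ) ⬝ᵥ
      (diagonal σ2 *ᵥ (c - t • (diagonal d *ᵥ φ) + t • φ))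
      - 2 * t * s * (c ⬝ᵥ (diagonal d *ᵥ φ))
      + t ^ 2 * s * ((diagonal d *ᵥ φ) ⬝ᵥ (diagonal d *ᵥ φ))
      = c ⬝ᵥ (diagonal σ2 *ᵥ c) + t ^ 2 * s * (φ ⬝ᵥ (diagonal d *ᵥ φ)) := by
    simp only [dotProduct, mulVec_diagonal, Finset.mul_sum, ← Finset.sum_add_distrib,
      ← Finset.sum_sub_distrib, Pi.add_apply, Pi.sub_apply, Pi.smul_apply, smul_eq_mul]
    refine Finset.sum_congr rfl fun j _ => ?_
    have := hσ2 j
    have h0 : s + σ2 j ≠ 0 := by positivity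
    rw [hd]
    field_simp
    ring
  linear_combination h3


open Matrix MeasureTheory ProbabilityTheory

/-- A measure on `ℝ^n` is Gaussian with mean `m` and covariance `S` iff every linear
functional pushes it forward to the corresponding one-dimensional Gaussian. -/
def IsGaussianLaw {n : ℕ} (μ : Measure (Fin n → ℝ)) (m : Fin n → ℝ)
    (S : Matrix (Fin n) (Fin n) ℝ) : Prop :=
  ∀ a : Fin n → ℝ,
    μ.map (fun x => a ⬝ᵥ x) = gaussianReal (a ⬝ᵥ m) (a ⬝ᵥ S.mulVec a).toNNReal

/-- FDLM out-of-sample conditional distribution: with `ε = Φ e + η`, `e ~ N(0, Σ)`,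
`η ~ N(0, ση² I)` independent, `ε* = φᵀ e + η*`, `η* ~ N(0, ση²)` independent of `(e, η)`,
and `Φᵀ Φ = I`, the conditional law of `ε*` given `ε` is
`N(φᵀ Σ̃ Φᵀ ε, ση² + ση² φᵀ Σ̃ φ)` with `Σ̃ = diag (σⱼ²/(ση²+σⱼ²))`. -/
theorem fdlm_out_of_sample_conditional {Ω : Type*} [MeasureSpace Ω]
    [IsProbabilityMeasure (volume : Measure Ω)] {M J : ℕ}
    (Φ : Matrix (Fin M) (Fin J) ℝ) (hΦ : Φᵀ * Φ = 1)
    (σ2 : Fin J → ℝ) (hσ2 : ∀ j, 0 < σ2 j) (ση2 : ℝ) (hση2 : 0 < ση2)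
    (φ : Fin J → ℝ)
    (e : Ω → Fin J → ℝ) (η : Ω → Fin M → ℝ) (ηstar : Ω → ℝ)
    (he : Measurable e) (hη : Measurable η) (hηstar : Measurable ηstar)
    (heGauss : IsGaussianLaw ((volume : Measure Ω).map e) 0 (Matrix.diagonal σ2))
    (hηGauss : IsGaussianLaw ((volume : Measure Ω).map η) 0
      (ση2 • (1 : Matrix (Fin M) (Fin M) ℝ)))
    (hηstarGauss : (volume : Measure Ω).map ηstar = gaussianReal 0 ση2.toNNReal)
    (hindep1 : IndepFun e η volume)
    (hindep2 : IndepFun ηstar (fun ω => (e ω, η ω)) volume)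
    (ε : Ω → Fin M → ℝ) (hε : ∀ ω, ε ω = Φ.mulVec (e ω) + η ω)
    (εstar : Ω → ℝ) (hεstar : ∀ ω, εstar ω = φ ⬝ᵥ e ω + ηstar ω) :
    ∀ᵐ ω, (condDistrib εstar ε (volume : Measure Ω)) (ε ω) =
      gaussianReal
        (φ ⬝ᵥ (Matrix.diagonal (fun j => σ2 j / (ση2 + σ2 j))).mulVec (Φᵀ.mulVec (ε ω)))
        (ση2 + ση2 *
          (φ ⬝ᵥ (Matrix.diagonal (fun j => σ2 j / (ση2 + σ2 j))).mulVec φ)).toNNReal := by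
  set s := ση2 with hs
  let d : Fin J → ℝ := fun j => σ2 j / (s + σ2 j)
  let b : Fin M → ℝ := Φ *ᵥ (diagonal d *ᵥ φ)
  have hd0 : ∀ j, 0 < d j := fun j => by
    have := hσ2 j
    simp only [d]; positivity
  have hdot : ∀ {n : ℕ} (a : Fin n → ℝ), Measurable (fun x : Fin n → ℝ => a ⬝ᵥ x) := by
    intro n a
    simp only [dotProduct]
    fun_prop
  have hquad : ∀ (w : Fin J → ℝ), (∀ j, 0 < w j) → ∀ c : Fin J → ℝ,
      0 ≤ c ⬝ᵥ (diagonal w *ᵥ c) := by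
    intro w hw c
    simp only [dotProduct, mulVec_diagonal]
    refine Finset.sum_nonneg fun j _ => ?_
    have := (hw j).le
    nlinarith [mul_nonneg this (mul_self_nonneg (c j))]
  have hself : ∀ {n : ℕ} (c : Fin n → ℝ), 0 ≤ c ⬝ᵥ c := fun c =>
    Finset.sum_nonneg fun j _ => mul_self_nonneg (c j)
  have hεm : Measurable ε := by
    rw [show ε = fun ω => Φ *ᵥ (e ω) + η ω from funext hε]
    refine Measurable.add ?_ hη
    refine measurable_pi_lambda _ fun i => ?_
    exact (hdot (Φ i)).comp he
  let R : Ω → ℝ := fun ω => φ ⬝ᵥ e ω + ηstar ω - b ⬝ᵥ ε ω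
  have hR : Measurable R :=
    (((hdot φ).comp he).add hηstar).sub ((hdot b).comp hεm)
  let v : ℝ := s + s * (φ ⬝ᵥ (diagonal d *ᵥ φ))
  have hv : 0 ≤ v := by
    have := hquad d hd0 φ
    simp only [v]; positivity
  let Q : (Fin M → ℝ) → ℝ := fun a =>
    (Φᵀ *ᵥ a) ⬝ᵥ (diagonal σ2 *ᵥ (Φᵀ *ᵥ a)) + s * (a ⬝ᵥ a)
  have hQ : ∀ a, 0 ≤ Q a := fun a => by
    have h1 := hquad σ2 hσ2 (Φᵀ *ᵥ a)
    have h2 := hself a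
    simp only [Q]; positivity
  have hjoint : ∀ a t, (volume : Measure Ω).map (fun ω => a ⬝ᵥ ε ω + t * R ω)
      = gaussianReal 0 (Q a + t ^ 2 * v).toNNReal := by
    intro a t
    let p : Fin J → ℝ := Φᵀ *ᵥ (a - t • b) + t • φ
    let q : Fin M → ℝ := a - t • b
    have l1 : (volume : Measure Ω).map (fun ω => p ⬝ᵥ e ω)
        = gaussianReal 0 (p ⬝ᵥ (diagonal σ2 *ᵥ p)).toNNReal := by
      have := heGauss p
      rw [Measure.map_map (hdot p) he, dotProduct_zero] at this
      exact this
    have l2 : (volume : Measure Ω).map (fun ω => q ⬝ᵥ η ω)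
        = gaussianReal 0 (q ⬝ᵥ ((s • (1 : Matrix (Fin M) (Fin M) ℝ)) *ᵥ q)).toNNReal := by
      have := hηGauss q
      rw [Measure.map_map (hdot q) hη, dotProduct_zero] at this
      exact this
    have l3 : (volume : Measure Ω).map (fun ω => t * ηstar ω)
        = gaussianReal 0 (t ^ 2 * s).toNNReal := by
      have := gaussianReal_map_const_mul (μ := 0) (v := s.toNNReal) t
      rw [← hηstarGauss, Measure.map_map (by fun_prop) hηstar, mul_zero] at this
      refine this.trans ?_
      congr 1
      ext
      have : 0 ≤ t ^ 2 * s := by positivity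
      simp [hση2.le, this]
    have i1 : IndepFun (fun ω => p ⬝ᵥ e ω) (fun ω => q ⬝ᵥ η ω) volume :=
      hindep1.comp (hdot p) (hdot q)
    have i2 : IndepFun (fun ω => p ⬝ᵥ e ω + q ⬝ᵥ η ω) (fun ω => t * ηstar ω) volume :=
      (hindep2.comp (φ := fun x => t * x)
        (ψ := fun z : (Fin J → ℝ) × (Fin M → ℝ) => p ⬝ᵥ z.1 + q ⬝ᵥ z.2) (by fun_prop)
        (((hdot p).comp measurable_fst).add ((hdot q).comp measurable_snd))).symm
    have g1 := gaussianReal_add_gaussianReal_of_indepFun i1 l1 l2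
    have g2 := gaussianReal_add_gaussianReal_of_indepFun i2 g1 l3
    have hp0 := hquad σ2 hσ2 p
    have hq0 : 0 ≤ q ⬝ᵥ ((s • (1 : Matrix (Fin M) (Fin M) ℝ)) *ᵥ q) := by
      rw [smul_mulVec, one_mulVec, dotProduct_smul, smul_eq_mul]
      exact mul_nonneg hση2.le (hself q)
    have ht0 : 0 ≤ t ^ 2 * s := by positivity
    rw [← Real.toNNReal_add hp0 hq0, ← Real.toNNReal_add (add_nonneg hp0 hq0) ht0] at g2
    have hvar := fdlm_variance Φ hΦ σ2 hσ2 s hση2 φ d (fun j => rfl) b rfl a t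
    simp only [p, q] at g2
    rw [hvar, add_zero, add_zero] at g2
    refine Eq.trans ?_ g2
    congr 1
    funext ω
    have hT : (Φᵀ *ᵥ (a - t • b)) ⬝ᵥ e ω = (a - t • b) ⬝ᵥ (Φ *ᵥ e ω) := by
      rw [dotProduct_mulVec, mulVec_transpose]
    simp only [Pi.add_apply, R, hε ω]
    rw [add_dotProduct, hT]
    simp only [sub_dotProduct, dotProduct_add, smul_dotProduct, smul_eq_mul]
    ring
  obtain ⟨hind, hlaw⟩ := indep_and_law_of_joint volume ε R hεm hR Q hQ (by simp [Q]) v hv hjoint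
  have hfin := condDistrib_of_indep_residual volume ε R εstar hεm hR (fun x => b ⬝ᵥ x) (hdot b)
    v.toNNReal hind hlaw (fun ω => by simp only [R, hεstar ω]; ring)
  have hmean : ∀ x : Fin M → ℝ, φ ⬝ᵥ (diagonal d *ᵥ (Φᵀ *ᵥ x)) = b ⬝ᵥ x := by
    intro x
    rw [dotProduct_mulVec, dotProduct_mulVec, vecMul_transpose]
    congr 2
    funext j
    simp [vecMul_diagonal, mulVec_diagonal, mul_comm]
  filter_upwards [hfin] with ω hω
  rw [hω, ← hmean]
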